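/- For every n ≥ 1, the complement in 𝕋ⁿ of the closure of Ārg(H) is a nonempty connected open subset of 𝕋ⁿ. -/

import Mathlib

instance : Fact (0 < 2 * Real.pi) := ⟨by positivity⟩

open Filter Topology in
/-- If a nontrivial nonnegative combination of unit vectors vanishes, then their angles are limits
of tuples of arguments of nonzero complex numbers summing to zero. -/
theorem mem_closure_args_of_nonneg_combination {ι : Type*} [Fintype ι] (α : ι → Real.Angle)
    (c : ι → ℝ) (hc : ∀ i, 0 ≤ c i) (hsum : ∑ i, c i = 1)
    (hzero : ∑ i, (c i : ℂ) * ((α i).toCircle : ℂ) = 0) :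
    α ∈ closure {β : ι → Real.Angle | ∃ z : ι → ℂ, (∀ i, z i ≠ 0) ∧ ∑ i, z i = 0 ∧
      ∀ i, β i = ((z i).arg : Real.Angle)} := by
  classical
  obtain ⟨k, hk⟩ : ∃ k, 0 < c k := by
    by_contra! h
    linarith [Finset.sum_nonpos fun i (_ : i ∈ Finset.univ) => h i]
  have harg : ∀ i (r : ℝ), 0 < r →
      (((r : ℂ) * ((α i).toCircle : ℂ)).arg : Real.Angle) = α i := fun i r hr => by
    rw [Complex.arg_real_mul _ hr, Real.Angle.arg_toCircle]
  set w : ℂ := ∑ i, ((α i).toCircle : ℂ) with hw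
  set F : ℝ → ι → ℂ := fun ε i =>
    ((c i + ε : ℝ) : ℂ) * ((α i).toCircle : ℂ) - if i = k then (ε : ℂ) * w else 0 with hF
  have hFsum : ∀ ε, ∑ i, F ε i = 0 := fun ε => by
    simp [hF, Finset.sum_sub_distrib, add_mul, Finset.sum_add_distrib, hzero, ← Finset.mul_sum, hw]
  have hFne : ∀ i ≠ k, ∀ ε, F ε i = ((c i + ε : ℝ) : ℂ) * ((α i).toCircle : ℂ) :=
    fun i hi ε => by simp [hF, hi]
  have hF0 : F 0 k = (c k : ℂ) * ((α k).toCircle : ℂ) := by simp [hF]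
  have hF0' : F 0 k ≠ 0 := by
    rw [hF0]
    exact mul_ne_zero (by exact_mod_cast hk.ne') (Circle.coe_ne_zero _)
  have hFcont : ContinuousAt (fun ε => F ε k) 0 := by
    simp only [hF, if_true]
    fun_prop
  have hpos : ∀ᶠ ε : ℝ in 𝓝[>] 0, 0 < ε := self_mem_nhdsWithin
  have hk_ne : ∀ᶠ ε in 𝓝[>] (0 : ℝ), F ε k ≠ 0 :=
    (hFcont.eventually_ne hF0').filter_mono nhdsWithin_le_nhds
  refine mem_closure_of_tendsto (b := 𝓝[>] (0 : ℝ))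
    (f := fun ε i => ((F ε i).arg : Real.Angle)) (tendsto_pi_nhds.2 fun i => ?_) ?_
  · by_cases hi : i = k
    · subst hi
      have h := (ContinuousAt.comp (f := fun ε => F ε i)
        (Complex.continuousAt_arg_coe_angle hF0') hFcont).tendsto
      simp only [Function.comp_def, hF0, harg _ _ hk] at h
      exact h.mono_left nhdsWithin_le_nhds
    · refine tendsto_const_nhds.congr' ?_
      filter_upwards [hpos] with ε hε
      rw [hFne i hi, harg i _ (add_pos_of_nonneg_of_pos (hc i) hε)]
  · filter_upwards [hpos, hk_ne] with ε hε hεk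
    refine ⟨F ε, fun i => ?_, hFsum ε, fun i => rfl⟩
    by_cases hi : i = k
    · rwa [hi]
    · rw [hFne i hi]
      have : c i + ε ≠ 0 := (add_pos_of_nonneg_of_pos (hc i) hε).ne'
      exact mul_ne_zero (by exact_mod_cast this) (Circle.coe_ne_zero _)

/-- A linear functional on `ℂ` positive at `1` evaluates on unit vectors as a positive multiple of a
shifted cosine. -/
theorem exists_angle_forall_pos_iff_cos_pos (f : ℂ →ₗ[ℝ] ℝ) (hf : f ≠ 0) :
    ∃ φ : Real.Angle, ∀ θ : Real.Angle, 0 < f (θ.toCircle : ℂ) ↔ 0 < (θ + φ).cos := by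
  set a : ℂ := ⟨f 1, -f Complex.I⟩ with ha
  have hfa : ∀ z : ℂ, f z = (z * a).re := fun z => by
    have hz : z = z.re • (1 : ℂ) + z.im • Complex.I := by simp
    conv_lhs => rw [hz, map_add, map_smul, map_smul]
    simp [ha, Complex.mul_re]
  have ha0 : a ≠ 0 := fun h => hf (LinearMap.ext fun z => by simp [hfa, h])
  refine ⟨(a.arg : Real.Angle), fun θ => ?_⟩
  have hprod : (θ.toCircle : ℂ) * a =
      (‖a‖ : ℂ) * ((θ + (a.arg : Real.Angle)).toCircle : ℂ) := by
    conv_lhs => rw [← Complex.norm_mul_exp_arg_mul_I a]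
    rw [Real.Angle.toCircle_add, Real.Angle.toCircle_coe, Circle.coe_mul, Circle.coe_exp]
    ring
  rw [hfa, hprod, Complex.re_ofReal_mul, mul_pos_iff_of_pos_left (norm_pos_iff.2 ha0),
    Real.Angle.coe_toCircle]
  simp

/-- Unit vectors either lie in a common open half-plane or have a vanishing convex combination. -/
theorem exists_cos_pos_or_convex_combination_eq_zero {ι : Type*} [Fintype ι] [Nonempty ι]
    (α : ι → Real.Angle) :
    (∃ φ : Real.Angle, ∀ i, 0 < (α i + φ).cos) ∨
      ∃ c : ι → ℝ, (∀ i, 0 ≤ c i) ∧ ∑ i, c i = 1 ∧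
        ∑ i, (c i : ℂ) * ((α i).toCircle : ℂ) = 0 := by
  set v : ι → ℂ := fun i => ((α i).toCircle : ℂ)
  by_cases h : (0 : ℂ) ∈ convexHull ℝ (Set.range v)
  · right
    rw [convexHull_range_eq_exists_affineCombination] at h
    obtain ⟨s, w, hw0, hw1, hw⟩ := h
    rw [s.affineCombination_eq_linear_combination _ _ hw1] at hw
    classical
    refine ⟨fun i => if i ∈ s then w i else 0, fun i => ?_, by simpa using hw1, ?_⟩
    · by_cases hi : i ∈ s <;> simp [hi, hw0]
    · simpa [apply_ite, ite_mul] using hw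
  · left
    obtain ⟨f, u, hu, hf⟩ := geometric_hahn_banach_point_closed (convex_convexHull ℝ _)
      ((Set.finite_range v).isClosed_convexHull ℝ) h
    rw [map_zero] at hu
    have hpos : ∀ i, 0 < f (v i) := fun i =>
      hu.trans (hf _ (subset_convexHull ℝ _ (Set.mem_range_self i)))
    obtain ⟨φ, hφ⟩ := exists_angle_forall_pos_iff_cos_pos (f : ℂ →ₗ[ℝ] ℝ) fun h0 => by
      have := hpos (Classical.arbitrary ι)
      rw [← ContinuousLinearMap.coe_coe, h0] at this
      simp at this
    exact ⟨φ, fun i => (hφ _).1 (hpos i)⟩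

theorem isConnected_setOf_angle_cos_pos : IsConnected {a : Real.Angle | 0 < a.cos} := by
  have himage : {a : Real.Angle | 0 < a.cos} =
      (fun x : ℝ => (x : Real.Angle)) '' Set.Ioo (-(Real.pi / 2)) (Real.pi / 2) := by
    ext a
    constructor
    · intro ha
      exact ⟨a.toReal, abs_lt.1 (Real.Angle.cos_pos_iff_abs_toReal_lt_pi_div_two.1 ha),
        a.coe_toReal⟩
    · rintro ⟨x, hx, rfl⟩
      exact Real.cos_pos_of_mem_Ioo hx
  rw [himage]
  exact (isConnected_Ioo (by linarith [Real.pi_pos])).image _ Real.Angle.continuous_coe.continuousOn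

/-- The coamoeba of the standard hyperplane, in terms of `Real.Angle`. -/
def hyperplaneCoamoeba (n : ℕ) : Set (Fin n → Real.Angle) :=
  {θ | ∃ z : Fin n → ℂ, (∀ i, z i ≠ 0) ∧ (1 + ∑ i, z i) = 0 ∧
    ∀ i, θ i = ((z i).arg : Real.Angle)}

/-- The angles `θ` such that `1` and the unit vectors of angles `θ i` lie in an open half-plane. -/
def openHalfPlaneAngles (n : ℕ) : Set (Fin n → Real.Angle) :=
  {θ | ∃ φ : Real.Angle, 0 < φ.cos ∧ ∀ i, 0 < (θ i + φ).cos}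

theorem isOpen_openHalfPlaneAngles (n : ℕ) : IsOpen (openHalfPlaneAngles n) := by
  have hunion : openHalfPlaneAngles n = ⋃ φ : Real.Angle, ⋃ (_ : 0 < φ.cos),
      ⋂ i, {θ : Fin n → Real.Angle | 0 < (θ i + φ).cos} := by
    ext θ
    simp [openHalfPlaneAngles]
  rw [hunion]
  refine isOpen_iUnion fun φ => isOpen_iUnion fun _ => isOpen_iInter_of_finite fun i => ?_
  exact isOpen_lt continuous_const
    (Real.Angle.continuous_cos.comp ((continuous_apply i).add continuous_const))

theorem isConnected_openHalfPlaneAngles (n : ℕ) : IsConnected (openHalfPlaneAngles n) := by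
  have himage : openHalfPlaneAngles n =
      (fun p : Real.Angle × (Fin n → Real.Angle) => fun i => p.2 i - p.1) ''
        ({a | 0 < a.cos} ×ˢ Set.univ.pi fun _ => {a | 0 < a.cos}) := by
    ext θ
    constructor
    · rintro ⟨φ, hφ, h⟩
      exact ⟨(φ, fun i => θ i + φ), ⟨hφ, fun i _ => h i⟩, by simp⟩
    · rintro ⟨⟨φ, ψ⟩, ⟨hφ, hψ⟩, rfl⟩
      exact ⟨φ, hφ, fun i => by simpa using hψ i (Set.mem_univ i)⟩
  rw [himage]
  exact (isConnected_setOf_angle_cos_pos.prod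
    (isConnected_univ_pi.2 fun _ => isConnected_setOf_angle_cos_pos)).image _
      (by fun_prop)

theorem disjoint_openHalfPlaneAngles_hyperplaneCoamoeba (n : ℕ) :
    Disjoint (openHalfPlaneAngles n) (hyperplaneCoamoeba n) := by
  rw [Set.disjoint_left]
  rintro θ ⟨φ, hφ, hθ⟩ ⟨z, hz, hsum, harg⟩
  have hterm : ∀ i, (z i * (φ.toCircle : ℂ)).re = ‖z i‖ * (θ i + φ).cos := fun i => by
    have h : z i * (φ.toCircle : ℂ) = (‖z i‖ : ℂ) * ((θ i + φ).toCircle : ℂ) := by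
      conv_lhs => rw [← Complex.norm_mul_exp_arg_mul_I (z i)]
      rw [Real.Angle.toCircle_add, harg i, Real.Angle.toCircle_coe, Circle.coe_mul, Circle.coe_exp]
      ring
    rw [h, Complex.re_ofReal_mul, Real.Angle.coe_toCircle]
    simp
  have h := congrArg (fun w : ℂ => (w * (φ.toCircle : ℂ)).re) hsum
  simp only [add_mul, one_mul, Finset.sum_mul, Complex.add_re, Complex.re_sum, hterm, zero_mul,
    Complex.zero_re] at h
  have hφre : ((φ.toCircle : Circle) : ℂ).re = φ.cos := by simp [Real.Angle.coe_toCircle]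
  have hnonneg : 0 ≤ ∑ i, ‖z i‖ * (θ i + φ).cos :=
    Finset.sum_nonneg fun i _ => mul_nonneg (norm_nonneg _) (hθ i).le
  linarith

theorem compl_closure_hyperplaneCoamoeba (n : ℕ) :
    (closure (hyperplaneCoamoeba n))ᶜ = openHalfPlaneAngles n := by
  apply Set.Subset.antisymm
  · intro θ hθ
    set α : Option (Fin n) → Real.Angle := fun o => o.elim 0 θ with hα
    rcases exists_cos_pos_or_convex_combination_eq_zero α with ⟨φ, hφ⟩ | ⟨c, hc, hsum, hzero⟩
    · exact ⟨φ, by simpa [hα] using hφ none, fun i => hφ (some i)⟩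
    · refine absurd ?_ hθ
      have hmaps := map_mem_closure
        (f := fun (β : Option (Fin n) → Real.Angle) (i : Fin n) => β (some i) - β none)
        (t := hyperplaneCoamoeba n) (by fun_prop)
        (mem_closure_args_of_nonneg_combination α c hc hsum hzero) ?_
      · simpa [hα] using hmaps
      · rintro β ⟨z, hz, hz0, hβ⟩
        refine ⟨fun i => z (some i) / z none, fun i => div_ne_zero (hz _) (hz _), ?_, fun i => ?_⟩
        · rw [Fintype.sum_option] at hz0
          rw [← Finset.sum_div]
          field_simp [hz none]
          rw [hz0, mul_zero]
        · simp only [hβ]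
          rw [Complex.arg_div_coe_angle (hz _) (hz _)]
  · exact Set.subset_compl_iff_disjoint_right.2
      ((disjoint_openHalfPlaneAngles_hyperplaneCoamoeba n).closure_right
        (isOpen_openHalfPlaneAngles n))

/-- The complement in the torus `𝕋ⁿ = (ℝ/2πℤ)ⁿ` of the closure of the coamoeba `Ārg(H)` of the
standard hyperplane is a nonempty connected open subset. -/
theorem coamoeba_complement_connected (n : ℕ) (hn : 1 ≤ n)
    (ArgH : Set (Fin n → AddCircle (2 * Real.pi)))
    (hArgH : ArgH = {θ | ∃ z : Fin n → ℂ, (∀ i, z i ≠ 0) ∧ (1 + ∑ i, z i) = 0 ∧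
        ∀ i, θ i = ((Complex.arg (z i) : ℝ) : AddCircle (2 * Real.pi))}) :
    (closure ArgH)ᶜ.Nonempty ∧ IsConnected (closure ArgH)ᶜ ∧ IsOpen (closure ArgH)ᶜ := by
  have hconn : IsConnected (closure ArgH)ᶜ := by
    have h := isConnected_openHalfPlaneAngles n
    rw [← compl_closure_hyperplaneCoamoeba] at h
    rw [hArgH]
    exact h
  exact ⟨hconn.nonempty, hconn, isClosed_closure.isOpen_compl⟩
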